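/- Let Σ be a Shy set of Datalog∃ rules, D a database, and q a Boolean conjunctive query. Then ochase(D,Σ) ⊨ q if and only if pchase_r(D,Σ) ⊨ q, where pchase_r denotes the parsimonious chase with resumption. -/

import Mathlib

noncomputable section

open Classical

/-! ## Syntax of Datalog∃ -/

/-- Terms appearing in rules: constants or (regular) variables. -/
inductive RTerm (C V : Type) : Type where
  | const : C → RTerm C V
  | var   : V → RTerm C V

/-- An atom over a relational schema: a predicate symbol applied to a tuple of terms. -/
structure RAtom (P C V : Type) : Type where
  pred : P
  args : List (RTerm C V)

/-- An existential rule ∀x̄∀ȳ (φ(x̄,ȳ) → ∃z̄ ψ(x̄,z̄)): `body` is φ, `head` is ψ,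
`exVars` is the set of existentially quantified variables z̄ of the head. -/
structure Rule (P C V : Type) : Type where
  body   : List (RAtom P C V)
  head   : List (RAtom P C V)
  exVars : Set V

variable {P C V : Type}

/-- Variable `x` occurs at position `i` (0-based) of atom `a`. -/
def occursAt (x : V) (a : RAtom P C V) (i : ℕ) : Prop :=
  a.args[i]? = some (RTerm.var x)

/-- Variable `x` occurs in atom `a`. -/
def occursIn (x : V) (a : RAtom P C V) : Prop := ∃ i, occursAt x a i

/-- Variable `x` occurs in the conjunction of atoms `ς`. -/
def occursInConj (x : V) (ς : List (RAtom P C V)) : Prop := ∃ a ∈ ς, occursIn x a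

/-- A position `p[i]`: the `i`-th argument of predicate `p`. -/
abbrev Pos (P : Type) := P × ℕ

/-- The affected positions of a set `S` of rules: `p[i]` is affected if (i) `p` appears
in a rule with an ∃-variable in its `i`-th term, or (ii) there is a rule in which
a ∀-variable occurs only in affected body positions and occurs in `p[i]` in the head. -/
inductive Affected (S : Set (Rule P C V)) : Pos P → Prop where
  | base (ρ : Rule P C V) (a : RAtom P C V) (i : ℕ) (y : V) :
      ρ ∈ S → a ∈ ρ.head → occursAt y a i → y ∈ ρ.exVars →
      Affected S (a.pred, i)
  | step (ρ : Rule P C V) (a : RAtom P C V) (i : ℕ) (x : V) :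
      ρ ∈ S → a ∈ ρ.head → occursAt x a i → x ∉ ρ.exVars →
      occursInConj x ρ.body →
      (∀ b ∈ ρ.body, ∀ j, occursAt x b j → Affected S (b.pred, j)) →
      Affected S (a.pred, i)

/-- Position `p[i]` is invaded by the ∃-variable `y`: there is a rule `ρ` with head
atom over `p` whose `i`-th term either is `y` itself (an ∃-variable of `ρ`), or is a
∀-variable occurring in `body(ρ)` only in positions invaded by `y`. -/
inductive Invaded (S : Set (Rule P C V)) (y : V) : Pos P → Prop where
  | base (ρ : Rule P C V) (a : RAtom P C V) (i : ℕ) :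
      ρ ∈ S → a ∈ ρ.head → occursAt y a i → y ∈ ρ.exVars →
      Invaded S y (a.pred, i)
  | step (ρ : Rule P C V) (a : RAtom P C V) (i : ℕ) (x : V) :
      ρ ∈ S → a ∈ ρ.head → occursAt x a i → x ∉ ρ.exVars →
      occursInConj x ρ.body →
      (∀ b ∈ ρ.body, ∀ j, occursAt x b j → Invaded S y (b.pred, j)) →
      Invaded S y (a.pred, i)

/-- `x` is attacked by `y` in the conjunction `ς`: `x` occurs in `ς` and only in
positions invaded by `y`. -/
def AttackedIn (S : Set (Rule P C V)) (x : V) (ς : List (RAtom P C V)) (y : V) : Prop :=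
  occursInConj x ς ∧ ∀ a ∈ ς, ∀ i, occursAt x a i → Invaded S y (a.pred, i)

/-- `x` is protected in `ς`: it is attacked by no variable. -/
def ProtectedIn (S : Set (Rule P C V)) (x : V) (ς : List (RAtom P C V)) : Prop :=
  ∀ y, ¬ AttackedIn S x ς y

/-- `x` occurs in more than one atom of the conjunction `ς`. -/
def OccursInTwoAtoms (x : V) (ς : List (RAtom P C V)) : Prop :=
  ∃ (i j : ℕ) (a b : RAtom P C V), i ≠ j ∧ ς[i]? = some a ∧ ς[j]? = some b ∧ occursIn x a ∧ occursIn x b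

/-- Condition (S1): if a variable occurs in more than one body atom,
then it is protected in the body. -/
def CondS1 (S : Set (Rule P C V)) (σ : Rule P C V) : Prop :=
  ∀ x, OccursInTwoAtoms x σ.body → ProtectedIn S x σ.body

/-- Condition (S2): if two distinct ∀-variables are not protected in the body but occur
both in the head and in two different body atoms, then they are not attacked by the
same variable. -/
def CondS2 (S : Set (Rule P C V)) (σ : Rule P C V) : Prop :=
  ∀ x₁ x₂, x₁ ≠ x₂ → x₁ ∉ σ.exVars → x₂ ∉ σ.exVars →
    ¬ ProtectedIn S x₁ σ.body → ¬ ProtectedIn S x₂ σ.body →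
    occursInConj x₁ σ.head → occursInConj x₂ σ.head →
    (∃ (i j : ℕ) (a b : RAtom P C V), i ≠ j ∧ σ.body[i]? = some a ∧ σ.body[j]? = some b ∧
      occursIn x₁ a ∧ occursIn x₂ b) →
    ∀ y, ¬ (AttackedIn S x₁ σ.body y ∧ AttackedIn S x₂ σ.body y)

/-- Shy Datalog∃ programs. -/
def Shy (S : Set (Rule P C V)) : Prop := ∀ σ ∈ S, CondS1 S σ ∧ CondS2 S σ

/-- A ∀-variable `x` is harmful w.r.t. rule `σ` if it appears (in the body)
only in affected positions. -/
def Harmful (S : Set (Rule P C V)) (σ : Rule P C V) (x : V) : Prop :=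
  x ∉ σ.exVars ∧ occursInConj x σ.body ∧
    ∀ a ∈ σ.body, ∀ i, occursAt x a i → Affected S (a.pred, i)

/-- A ∀-variable of `σ` that is not harmful is harmless. -/
def Harmless (S : Set (Rule P C V)) (σ : Rule P C V) (x : V) : Prop :=
  x ∉ σ.exVars ∧ occursInConj x σ.body ∧ ¬ Harmful S σ x

/-- A harmful variable occurring in the head is dangerous. -/
def Dangerous (S : Set (Rule P C V)) (σ : Rule P C V) (x : V) : Prop :=
  Harmful S σ x ∧ occursInConj x σ.head

/-- Conditions (W1) and (W2) for a single rule: all dangerous variables appear in a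
single body atom (the ward), which shares only harmless variables with the other
body atoms. -/
def WardedRule (S : Set (Rule P C V)) (σ : Rule P C V) : Prop :=
  (∀ x, ¬ Dangerous S σ x) ∨
  ∃ w ∈ σ.body,
    (∀ x, Dangerous S σ x → occursIn x w) ∧
    (∀ b ∈ σ.body, b ≠ w → ∀ x, occursIn x w → occursIn x b → Harmless S σ x)

/-- Warded Datalog± programs. -/
def Warded (S : Set (Rule P C V)) : Prop := ∀ σ ∈ S, WardedRule S σ

/-- A harmful variable is attacked harmful w.r.t. `σ` if all its (affected)
body positions are invaded by one and the same ∃-variable. -/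
def AttackedHarmful (S : Set (Rule P C V)) (σ : Rule P C V) (x : V) : Prop :=
  Harmful S σ x ∧ ∃ y, AttackedIn S x σ.body y

/-- Rule `σ` contains an attacked harmful join: a join of two body atoms on an
attacked harmful variable. -/
def HasAttackedHarmfulJoin (S : Set (Rule P C V)) (σ : Rule P C V) : Prop :=
  ∃ x, AttackedHarmful S σ x ∧ OccursInTwoAtoms x σ.body

/-- Protected Datalog± programs: (P1) no rule contains attacked harmful joins, and
(P2) every rule is warded. -/
def ProtectedProgram (S : Set (Rule P C V)) : Prop :=
  ∀ σ ∈ S, ¬ HasAttackedHarmfulJoin S σ ∧ WardedRule S σ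

/-! ## Ground terms, facts, homomorphisms and the chase -/

/-- Ground terms: constants and labelled nulls. A labelled null is identified by the
chase step creating it: the rule, the homomorphism used, and the ∃-variable it
instantiates. -/
inductive GTerm (P C V : Type) : Type where
  | const : C → GTerm P C V
  | null  : Rule P C V → (V → GTerm P C V) → V → GTerm P C V

/-- A fact: a predicate applied to a tuple of ground terms. -/
structure GFact (P C V : Type) : Type where
  pred : P
  args : List (GTerm P C V)

/-- Apply an assignment of variables to a rule term. -/
def applyTerm (h : V → GTerm P C V) : RTerm C V → GTerm P C V
  | RTerm.const c => GTerm.const c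
  | RTerm.var x   => h x

/-- Apply an assignment of variables to a rule atom, producing a fact. -/
def applyAtom (h : V → GTerm P C V) (a : RAtom P C V) : GFact P C V :=
  ⟨a.pred, a.args.map (applyTerm h)⟩

/-- Extend the assignment `h` by mapping each ∃-variable of `ρ` to a fresh
labelled null. -/
def extendH (ρ : Rule P C V) (h : V → GTerm P C V) : V → GTerm P C V :=
  fun x => if x ∈ ρ.exVars then GTerm.null ρ h x else h x

/-- The facts `h′(head(ρ))` produced by the chase step `⟨ρ,h⟩`. -/
def headFacts (ρ : Rule P C V) (h : V → GTerm P C V) : Set (GFact P C V) :=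
  { f | ∃ a ∈ ρ.head, f = applyAtom (extendH ρ h) a }

/-- `h` maps the body of `ρ` into the instance `I`. -/
def BodyMapped (ρ : Rule P C V) (h : V → GTerm P C V) (I : Set (GFact P C V)) : Prop :=
  ∀ a ∈ ρ.body, applyAtom h a ∈ I

/-- Apply a mapping of ground terms to a fact. -/
def mapFact (g : GTerm P C V → GTerm P C V) (f : GFact P C V) : GFact P C V :=
  ⟨f.pred, f.args.map g⟩

/-- A homomorphism fixes every constant. -/
def IsHomMap (g : GTerm P C V → GTerm P C V) : Prop :=
  ∀ c : C, g (GTerm.const c) = GTerm.const c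

/-- `g` is a homomorphism from the fact set `F₁` to the fact set `F₂`. -/
def HomTo (g : GTerm P C V → GTerm P C V) (F₁ F₂ : Set (GFact P C V)) : Prop :=
  IsHomMap g ∧ ∀ f ∈ F₁, mapFact g f ∈ F₂

/-- `F₁` and `F₂` are isomorphic: there are mutually inverse homomorphisms
between them. -/
def Isomorphic (F₁ F₂ : Set (GFact P C V)) : Prop :=
  ∃ g g' : GTerm P C V → GTerm P C V,
    HomTo g F₁ F₂ ∧ HomTo g' F₂ F₁ ∧ (∀ t, g' (g t) = t) ∧ (∀ t, g (g' t) = t)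

/-- There is an isomorphic embedding of `F₁` into `F₂`. -/
def IsoEmbeds (F₁ F₂ : Set (GFact P C V)) : Prop :=
  ∃ F, F ⊆ F₂ ∧ Isomorphic F₁ F

/-- The oblivious chase: `D` together with all facts derivable by (unrestricted)
chase steps, each ∃-variable being instantiated with a fresh labelled null. -/
inductive OChase (S : Set (Rule P C V)) (D : Set (GFact P C V)) : GFact P C V → Prop where
  | base (f : GFact P C V) : f ∈ D → OChase S D f
  | step (ρ : Rule P C V) (h : V → GTerm P C V) (a : RAtom P C V) :
      ρ ∈ S → (∀ b ∈ ρ.body, OChase S D (applyAtom h b)) → a ∈ ρ.head →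
      OChase S D (applyAtom (extendH ρ h) a)

def ochase (S : Set (Rule P C V)) (D : Set (GFact P C V)) : Set (GFact P C V) :=
  { f | OChase S D f }

/-- Parsimonious applicability of the chase step `⟨ρ,h⟩` w.r.t. `I`: the body is
mapped into `I` and there is no homomorphism (fixing the terms in `Frozen`,
used for resumption) from `h(head(ρ))` to `I`. -/
def PApplicable (S : Set (Rule P C V)) (Frozen : Set (GTerm P C V))
    (ρ : Rule P C V) (h : V → GTerm P C V) (I : Set (GFact P C V)) : Prop :=
  ρ ∈ S ∧ BodyMapped ρ h I ∧
    ¬ ∃ g, HomTo g (headFacts ρ h) I ∧ ∀ t ∈ Frozen, g t = t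

def pchaseIter (S : Set (Rule P C V)) (Frozen : Set (GTerm P C V))
    (D : Set (GFact P C V)) : ℕ → Set (GFact P C V)
  | 0 => D
  | n + 1 =>
      pchaseIter S Frozen D n ∪
        { f | ∃ ρ h, PApplicable S Frozen ρ h (pchaseIter S Frozen D n) ∧
              f ∈ headFacts ρ h }

def pchaseFrom (S : Set (Rule P C V)) (Frozen : Set (GTerm P C V))
    (D : Set (GFact P C V)) : Set (GFact P C V) :=
  ⋃ n, pchaseIter S Frozen D n

/-- The parsimonious chase. -/
def pchase (S : Set (Rule P C V)) (D : Set (GFact P C V)) : Set (GFact P C V) :=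
  pchaseFrom S ∅ D

/-- The ground terms occurring in an instance. -/
def termsOf (I : Set (GFact P C V)) : Set (GTerm P C V) :=
  { t | ∃ f ∈ I, t ∈ f.args }

/-- Resumptions of the parsimonious chase: each resumption restarts the
parsimonious chase from the previous result, treating all previously
introduced labelled nulls as constants. -/
def pchaseResume (S : Set (Rule P C V)) (D : Set (GFact P C V)) : ℕ → Set (GFact P C V)
  | 0 => pchaseFrom S ∅ D
  | k + 1 => pchaseFrom S (termsOf (pchaseResume S D k)) (pchaseResume S D k)

/-- The parsimonious chase with resumption. -/
def pchaseR (S : Set (Rule P C V)) (D : Set (GFact P C V)) : Set (GFact P C V) :=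
  ⋃ k, pchaseResume S D k

/-- Isomorphism-based applicability of the chase step `⟨ρ,h⟩` w.r.t. `I`: the body is
mapped into `I` and there is no isomorphic embedding of `h(head(ρ))` into `I`. -/
def IApplicable (S : Set (Rule P C V)) (ρ : Rule P C V) (h : V → GTerm P C V)
    (I : Set (GFact P C V)) : Prop :=
  ρ ∈ S ∧ BodyMapped ρ h I ∧ ¬ IsoEmbeds (headFacts ρ h) I

def ichaseIter (S : Set (Rule P C V)) (D : Set (GFact P C V)) : ℕ → Set (GFact P C V)
  | 0 => D
  | n + 1 =>
      ichaseIter S D n ∪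
        { f | ∃ ρ h, IApplicable S ρ h (ichaseIter S D n) ∧ f ∈ headFacts ρ h }

/-- The isomorphism-based chase. -/
def ichase (S : Set (Rule P C V)) (D : Set (GFact P C V)) : Set (GFact P C V) :=
  ⋃ n, ichaseIter S D n

/-- A Boolean conjunctive query ∃Y ς: a conjunction of atoms over constants and
(existentially quantified) variables. -/
structure BCQ (P C V : Type) : Type where
  atoms : List (RAtom P C V)

/-- `I ⊨ q`: there is an assignment of the query variables to ground terms
(constants and labelled nulls) mapping every query atom into `I`. -/
def Models (I : Set (GFact P C V)) (q : BCQ P C V) : Prop :=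
  ∃ v : V → GTerm P C V, ∀ a ∈ q.atoms, applyAtom v a ∈ I

/-- A database: an instance whose facts contain only constants. -/
def IsDatabase (D : Set (GFact P C V)) : Prop :=
  ∀ f ∈ D, ∀ t ∈ f.args, ∃ c : C, t = GTerm.const c

/-! ## Monotonicity and soundness of the parsimonious chase with resumption -/

theorem subset_pchaseFrom (S : Set (Rule P C V)) (Frozen : Set (GTerm P C V))
    (D : Set (GFact P C V)) : D ⊆ pchaseFrom S Frozen D :=
  Set.subset_iUnion (pchaseIter S Frozen D) 0

theorem pchaseResume_mono (S : Set (Rule P C V)) (D : Set (GFact P C V)) :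
    Monotone (pchaseResume S D) :=
  monotone_nat_of_le_succ fun _ => subset_pchaseFrom S _ _

theorem pchaseFrom_subset_ochase {S : Set (Rule P C V)} {D E : Set (GFact P C V)}
    (Frozen : Set (GTerm P C V)) (hE : E ⊆ ochase S D) :
    pchaseFrom S Frozen E ⊆ ochase S D := by
  refine Set.iUnion_subset fun n => ?_
  induction n with
  | zero => exact hE
  | succ n ih =>
    refine Set.union_subset ih ?_
    rintro f ⟨ρ, h, ⟨hρ, hbody, -⟩, a, ha, rfl⟩
    exact OChase.step ρ h a hρ (fun b hb => ih (hbody b hb)) ha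

theorem pchaseR_subset_ochase (S : Set (Rule P C V)) (D : Set (GFact P C V)) :
    pchaseR S D ⊆ ochase S D := by
  refine Set.iUnion_subset fun k => ?_
  induction k with
  | zero => exact pchaseFrom_subset_ochase _ fun f hf => OChase.base f hf
  | succ k ih => exact pchaseFrom_subset_ochase _ ih

/-! ## Assignments -/

theorem applyAtom_congr {v w : V → GTerm P C V} {a : RAtom P C V}
    (h : ∀ x, RTerm.var x ∈ a.args → v x = w x) : applyAtom v a = applyAtom w a := by
  unfold applyAtom
  congr 1
  refine List.map_congr_left fun t ht => ?_
  cases t with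
  | const c => rfl
  | var x => exact h x ht

theorem mapFact_applyAtom {g : GTerm P C V → GTerm P C V} (hg : IsHomMap g)
    (v : V → GTerm P C V) (a : RAtom P C V) :
    mapFact g (applyAtom v a) = applyAtom (fun x => g (v x)) a := by
  simp only [mapFact, applyAtom, List.map_map]
  congr 1
  refine List.map_congr_left fun t _ => ?_
  cases t with
  | const c => exact hg c
  | var x => rfl

theorem mem_termsOf_of_applyAtom_mem {I : Set (GFact P C V)} {v : V → GTerm P C V}
    {a : RAtom P C V} {x : V} (h : applyAtom v a ∈ I) (hx : RTerm.var x ∈ a.args) :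
    v x ∈ termsOf I :=
  ⟨_, h, List.mem_map.2 ⟨_, hx, rfl⟩⟩

/-- The constants together with the ground terms occurring in an instance. -/
def domainOf (I : Set (GFact P C V)) : Set (GTerm P C V) :=
  Set.range GTerm.const ∪ termsOf I

/-- Replace the values of `h` at the ∃-variables of `ρ` by those of `w`. -/
def overrideEx (ρ : Rule P C V) (h w : V → GTerm P C V) : V → GTerm P C V :=
  fun x => if x ∈ ρ.exVars then w x else h x

/-! ## The parsimonious chase with resumption is a model of the rules -/

theorem eventually_mem_pchaseResume {S : Set (Rule P C V)} {D : Set (GFact P C V)}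
    {f : GFact P C V} (hf : f ∈ pchaseR S D) :
    ∀ᶠ k in Filter.atTop, f ∈ pchaseResume S D k := by
  obtain ⟨k, hk⟩ := Set.mem_iUnion.1 hf
  filter_upwards [Filter.eventually_ge_atTop k] with m hm
  exact pchaseResume_mono S D hm hk

theorem eventually_mem_domainOf {S : Set (Rule P C V)} {D : Set (GFact P C V)}
    {t : GTerm P C V} (ht : t ∈ domainOf (pchaseR S D)) :
    ∀ᶠ k in Filter.atTop, t ∈ domainOf (pchaseResume S D k) := by
  rcases ht with hc | ⟨f, hf, htf⟩
  · exact Filter.Eventually.of_forall fun _ => Or.inl hc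
  · filter_upwards [eventually_mem_pchaseResume hf] with k hk
    exact Or.inr ⟨f, hk, htf⟩

theorem exists_pchaseResume_stage {S : Set (Rule P C V)} {D : Set (GFact P C V)}
    {ρ : Rule P C V} {h : V → GTerm P C V} (hbody : BodyMapped ρ h (pchaseR S D))
    (hdom : ∀ x, h x ∈ domainOf (pchaseR S D)) :
    ∃ k, BodyMapped ρ h (pchaseResume S D k) ∧
      ∀ a ∈ ρ.head, ∀ x, RTerm.var x ∈ a.args → h x ∈ domainOf (pchaseResume S D k) := by
  have hb : ∀ᶠ k in Filter.atTop, ∀ a ∈ {a | a ∈ ρ.body},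
      applyAtom h a ∈ pchaseResume S D k :=
    (Filter.eventually_all_finite ρ.body.finite_toSet).2 fun a ha =>
      eventually_mem_pchaseResume (hbody a ha)
  have hh : ∀ᶠ k in Filter.atTop, ∀ a ∈ {a | a ∈ ρ.head}, ∀ t ∈ {t | t ∈ a.args},
      applyTerm h t ∈ domainOf (pchaseResume S D k) :=
    (Filter.eventually_all_finite ρ.head.finite_toSet).2 fun a _ =>
      (Filter.eventually_all_finite a.args.finite_toSet).2 fun t _ =>
        eventually_mem_domainOf <| match t with
          | .const c => Or.inl ⟨c, rfl⟩
          | .var x => hdom x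
  obtain ⟨k, hk, hk'⟩ := (hb.and hh).exists
  exact ⟨k, hk, fun a ha x hx => hk' a ha _ hx⟩

theorem exists_head_witness {S : Set (Rule P C V)} {D : Set (GFact P C V)}
    {ρ : Rule P C V} (hρ : ρ ∈ S) {h : V → GTerm P C V}
    (hbody : BodyMapped ρ h (pchaseR S D)) (hdom : ∀ x, h x ∈ domainOf (pchaseR S D)) :
    ∃ w : V → GTerm P C V, ∀ a ∈ ρ.head, applyAtom (overrideEx ρ h w) a ∈ pchaseR S D := by
  obtain ⟨k, hk, hterm⟩ := exists_pchaseResume_stage hbody hdom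
  by_cases happ : PApplicable S (termsOf (pchaseResume S D k)) ρ h (pchaseResume S D k)
  · refine ⟨fun x => GTerm.null ρ h x, fun a ha => ?_⟩
    have hfact : applyAtom (extendH ρ h) a ∈ pchaseResume S D (k + 1) :=
      Set.mem_iUnion.2 ⟨1, Or.inr ⟨ρ, h, happ, a, ha, rfl⟩⟩
    exact Set.mem_iUnion.2 ⟨k + 1, hfact⟩
  · obtain ⟨g, ⟨hg, hmap⟩, hfix⟩ : ∃ g, HomTo g (headFacts ρ h) (pchaseResume S D k) ∧
        ∀ t ∈ termsOf (pchaseResume S D k), g t = t := by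
      by_contra hno
      exact happ ⟨hρ, hk, hno⟩
    refine ⟨fun x => g (GTerm.null ρ h x), fun a ha => ?_⟩
    have himg := hmap _ ⟨a, ha, rfl⟩
    rw [mapFact_applyAtom hg] at himg
    refine Set.mem_iUnion.2 ⟨k, ?_⟩
    convert himg using 1
    refine applyAtom_congr fun x hx => ?_
    by_cases hex : x ∈ ρ.exVars
    · simp [overrideEx, extendH, hex]
    · simp only [overrideEx, extendH, hex, if_false]
      rcases hterm a ha x hx with ⟨c, hc⟩ | ht
      · rw [← hc, hg c]
      · exact (hfix _ ht).symm

theorem exists_head_witness_in_domain {S : Set (Rule P C V)} {D : Set (GFact P C V)}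
    (ρ : Rule P C V) (h : V → GTerm P C V) (hdom : ∀ x, h x ∈ domainOf (pchaseR S D)) :
    ∃ w : V → GTerm P C V, (∀ x, w x ∈ domainOf (pchaseR S D)) ∧
      (ρ ∈ S → BodyMapped ρ h (pchaseR S D) →
        ∀ a ∈ ρ.head, applyAtom (overrideEx ρ h w) a ∈ pchaseR S D) := by
  by_cases hcond : ρ ∈ S ∧ BodyMapped ρ h (pchaseR S D)
  · obtain ⟨w, hw⟩ := exists_head_witness hcond.1 hcond.2 hdom
    refine ⟨fun x => if w x ∈ domainOf (pchaseR S D) then w x else h x, fun x => ?_,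
      fun _ _ a ha => ?_⟩
    · dsimp only
      split_ifs with hx
      exacts [hx, hdom x]
    · convert hw a ha using 1
      refine applyAtom_congr fun x hx => ?_
      by_cases hex : x ∈ ρ.exVars
      · have hmem := mem_termsOf_of_applyAtom_mem (hw a ha) hx
        simp only [overrideEx, hex, if_true] at hmem ⊢
        exact if_pos (Or.inr hmem)
      · simp [overrideEx, hex]
  · exact ⟨h, hdom, fun hρ hb => absurd ⟨hρ, hb⟩ hcond⟩

/-! ## The oblivious chase is universal -/

/-- The map on ground terms that fixes the constants and sends a null `null ρ h x` to the
value at `x` that `F` chooses for `ρ` and the image of the assignment `h`. -/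
def interpTerm (F : Rule P C V → (V → GTerm P C V) → V → GTerm P C V) :
    GTerm P C V → GTerm P C V
  | GTerm.const c => GTerm.const c
  | GTerm.null ρ h x => F ρ (fun y => interpTerm F (h y)) x

theorem exists_homTo_ochase_pchaseR (S : Set (Rule P C V)) (D : Set (GFact P C V))
    (hD : IsDatabase D) : ∃ g, HomTo g (ochase S D) (pchaseR S D) := by
  have hF : ∀ (ρ : Rule P C V) (h : V → GTerm P C V), ∃ w : V → GTerm P C V,
      (∀ x, h x ∈ domainOf (pchaseR S D)) → (∀ x, w x ∈ domainOf (pchaseR S D)) ∧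
      (ρ ∈ S → BodyMapped ρ h (pchaseR S D) →
        ∀ a ∈ ρ.head, applyAtom (overrideEx ρ h w) a ∈ pchaseR S D) := by
    intro ρ h
    by_cases hdom : ∀ x, h x ∈ domainOf (pchaseR S D)
    · obtain ⟨w, hw⟩ := exists_head_witness_in_domain ρ h hdom
      exact ⟨w, fun _ => hw⟩
    · exact ⟨h, fun hdom' => absurd hdom' hdom⟩
  choose F hF using hF
  have hrange : ∀ t, interpTerm F t ∈ domainOf (pchaseR S D) := by
    intro t
    induction t with
    | const c => exact Or.inl ⟨c, rfl⟩
    | null ρ h x ih => exact (hF ρ _ ih).1 x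
  have hconst : IsHomMap (interpTerm F) := fun _ => rfl
  refine ⟨interpTerm F, hconst, fun f hf => ?_⟩
  induction hf with
  | base f hf =>
    have hid : mapFact (interpTerm F) f = f := by
      have hargs : f.args.map (interpTerm F) = f.args.map id :=
        List.map_congr_left fun t ht => by
          obtain ⟨c, rfl⟩ := hD f hf t ht
          rfl
      rw [mapFact, hargs, List.map_id]
    rw [hid]
    exact Set.mem_iUnion.2 ⟨0, subset_pchaseFrom S ∅ D hf⟩
  | step ρ h a hρ _ ha ih =>
    have hbody : BodyMapped ρ (fun x => interpTerm F (h x)) (pchaseR S D) := fun b hb => by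
      rw [← mapFact_applyAtom hconst]
      exact ih b hb
    rw [mapFact_applyAtom hconst]
    convert (hF ρ _ fun x => hrange (h x)).2 hρ hbody a ha using 1
    refine applyAtom_congr fun x _ => ?_
    by_cases hex : x ∈ ρ.exVars <;> simp [overrideEx, extendH, hex, interpTerm]

theorem Models.of_homTo {I J : Set (GFact P C V)} {q : BCQ P C V}
    {g : GTerm P C V → GTerm P C V} (hg : HomTo g I J) (hI : Models I q) : Models J q := by
  obtain ⟨v, hv⟩ := hI
  exact ⟨fun x => g (v x), fun a ha => mapFact_applyAtom hg.1 v a ▸ hg.2 _ (hv a ha)⟩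

/-! ## Statement 10: over Shy programs, ochase and pchase with resumption agree on BCQs -/

/-- Let Σ be a Shy set of Datalog∃ rules, D a database, and q a Boolean conjunctive
query. Then ochase(D,Σ) ⊨ q if and only if pchase_r(D,Σ) ⊨ q, where pchase_r is the
parsimonious chase with resumption. -/
theorem ochase_iff_pchaseR_of_shy (P C V : Type) (S : Set (Rule P C V))
    (hS : Shy S) (D : Set (GFact P C V)) (hD : IsDatabase D) (q : BCQ P C V) :
    Models (ochase S D) q ↔ Models (pchaseR S D) q := by
  obtain ⟨g, hg⟩ := exists_homTo_ochase_pchaseR S D hD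
  refine ⟨Models.of_homTo hg, ?_⟩
  rintro ⟨v, hv⟩
  exact ⟨v, fun a ha => pchaseR_subset_ochase S D (hv a ha)⟩
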